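/- arXiv:1204.5213 — 3 statements merged into one kernel-verified Lean document; each statement's English description precedes it below -/
import Mathlib

section
/- In the i-bit roof game G_{i-bit} (on n = 4i players), no ceiling has more than two distinct direct left-shifts. -/
/-- `S'` is a direct left-shift of `S`: some player `p ∈ S` with `p ≥ 2` and
`p − 1 ∉ S` is replaced by `p − 1`. -/
def DLS (S S' : Finset ℕ) : Prop :=
  ∃ p ∈ S, 2 ≤ p ∧ p - 1 ∉ S ∧ S' = insert (p - 1) (S.erase p)

/-- `S'` is a left-shift of `S` (a possibly empty sequence of direct
left-shifts). -/
def LeftShift : Finset ℕ → Finset ℕ → Prop :=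
  Relation.ReflTransGen DLS

/-- The `(k,i)`-encoding coalition `S_{k,i}` on players `{1,…,4i}`. -/
def enc (i k : ℕ) : Finset ℕ :=
  (Finset.Icc 1 i).biUnion fun j =>
    if Nat.testBit k (j - 1) then {4 * (j - 1) + 1, 4 * (j - 1) + 4}
    else {4 * (j - 1) + 2, 4 * (j - 1) + 3}

/-- The `i`-bit roof game `G_{i-bit}` on `n = 4i` players: a coalition is winning
iff it is a superset of a left-shift of `S_{k,i}` for some `k < 2^i`. -/
def GBit (i : ℕ) (C : Finset ℕ) : Prop :=
  ∃ k < 2 ^ i, ∃ T : Finset ℕ, LeftShift (enc i k) T ∧ T ⊆ C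

/-- `S` is a maximal losing coalition of the game `v` on players `{1,…,n}`. -/
def IsMaxLosing (n : ℕ) (v : Finset ℕ → Prop) (S : Finset ℕ) : Prop :=
  S ⊆ Finset.Icc 1 n ∧ ¬ v S ∧ ∀ j ∈ Finset.Icc 1 n, j ∉ S → v (insert j S)

/-- `S` is a ceiling of `v`: a maximal losing coalition all of whose left-shifts
other than itself are winning. -/
def IsCeiling (n : ℕ) (v : Finset ℕ → Prop) (S : Finset ℕ) : Prop :=
  IsMaxLosing n v S ∧ ∀ S', LeftShift S S' → S' ≠ S → v S'

/-- Number of members of `S` that are at most `m`. -/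
def cnt (S : Finset ℕ) (m : ℕ) : ℕ := (S.filter (· ≤ m)).card

lemma cnt_succ (S : Finset ℕ) (m : ℕ) :
    cnt S (m + 1) = cnt S m + if m + 1 ∈ S then 1 else 0 := by
  unfold cnt
  split_ifs with h
  · have : S.filter (· ≤ m + 1) = insert (m + 1) (S.filter (· ≤ m)) := by
      ext x; simp only [Finset.mem_filter, Finset.mem_insert]; grind
    rw [this, Finset.card_insert_of_notMem (by simp)]
  · congr 1
    ext x; simp only [Finset.mem_filter]; grind

lemma cnt_mono_set {S T : Finset ℕ} (h : S ⊆ T) (m : ℕ) : cnt S m ≤ cnt T m :=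
  Finset.card_le_card (Finset.filter_subset_filter _ h)

lemma cnt_mono (S : Finset ℕ) {m l : ℕ} (h : m ≤ l) : cnt S m ≤ cnt S l := by
  apply Finset.card_le_card
  intro x; simp only [Finset.mem_filter]; grind

lemma cnt_zero {S : Finset ℕ} (h : 0 ∉ S) : cnt S 0 = 0 := by
  unfold cnt
  rw [Finset.card_eq_zero]
  ext x; simp only [Finset.mem_filter]; grind

lemma cnt_shift {S : Finset ℕ} {p : ℕ} (hp : p ∈ S) (h2 : 2 ≤ p) (hq : p - 1 ∉ S) (m : ℕ) :
    cnt (insert (p - 1) (S.erase p)) m = cnt S m + if m = p - 1 then 1 else 0 := by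
  unfold cnt
  split_ifs with h
  · subst h
    have : (insert (p - 1) (S.erase p)).filter (· ≤ p - 1)
        = insert (p - 1) (S.filter (· ≤ p - 1)) := by
      ext x; simp only [Finset.mem_filter, Finset.mem_insert, Finset.mem_erase]; grind
    rw [this, Finset.card_insert_of_notMem (by simp [hq])]
  · rcases Nat.lt_or_ge m p with hm | hm
    · congr 1
      ext x; simp only [Finset.mem_filter, Finset.mem_insert, Finset.mem_erase]; grind
    · have : (insert (p - 1) (S.erase p)).filter (· ≤ m)
          = insert (p - 1) ((S.filter (· ≤ m)).erase p) := by
        ext x; simp only [Finset.mem_filter, Finset.mem_insert, Finset.mem_erase]; grind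
      rw [this, Finset.card_insert_of_notMem (by simp [hq])]
      exact Finset.card_erase_add_one (by simp [hp, hm])

lemma leftShift_cnt {S T : Finset ℕ} (h : LeftShift S T) (m : ℕ) : cnt S m ≤ cnt T m := by
  induction h with
  | refl => exact le_rfl
  | tail _ h ih =>
    obtain ⟨p, hp, h2, hq, rfl⟩ := h
    rw [cnt_shift hp h2 hq]; omega

lemma exists_leftShift {C : Finset ℕ} (h0 : 0 ∉ C) : ∀ (w : ℕ) (S : Finset ℕ),
    ∑ x ∈ S, x = w → (∀ m, cnt S m ≤ cnt C m) → ∃ T, LeftShift S T ∧ T ⊆ C := by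
  intro w
  induction w using Nat.strong_induction_on with
  | _ w ih =>
  intro S hw hd
  by_cases hsub : S ⊆ C
  · exact ⟨S, Relation.ReflTransGen.refl, hsub⟩
  obtain ⟨p, hpS, hpC⟩ := Finset.not_subset.1 hsub
  have hz : cnt C 0 = 0 := cnt_zero h0
  have h0S : 0 ∉ S := by
    intro h
    have h1 := hd 0
    have : 0 < cnt S 0 := Finset.card_pos.2 ⟨0, by simp [h]⟩
    omega
  have hex : ∃ m, m + 1 ∈ S ∧ cnt S m < cnt C m := by
    obtain _ | q := p
    · exact absurd hpS h0S
    refine ⟨q, hpS, ?_⟩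
    have h1 := hd (q + 1)
    rw [cnt_succ, cnt_succ, if_pos hpS, if_neg hpC] at h1
    omega
  classical
  obtain ⟨hm1, hm2⟩ := Nat.find_spec hex
  have hmin := fun l => Nat.find_min hex (m := l)
  generalize Nat.find hex = m at hm1 hm2 hmin
  have hmpos : 0 < m := by
    rcases Nat.eq_zero_or_pos m with rfl | h
    · omega
    · exact h
  have hmS : m ∉ S := by
    intro h
    obtain _ | q := m
    · omega
    apply hmin q (by omega)
    refine ⟨h, ?_⟩
    rw [cnt_succ, cnt_succ, if_pos h] at hm2
    split_ifs at hm2 <;> omega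
  have hsum : ∑ x ∈ insert (m + 1 - 1) (S.erase (m + 1)), x < w := by
    rw [Finset.sum_insert (by simp [hmS])]
    have := Finset.add_sum_erase S (fun x => x) hm1
    omega
  obtain ⟨T, hT, hTC⟩ := ih _ hsum _ rfl (by
    intro l
    rw [cnt_shift hm1 (by omega) (by simpa using hmS)]
    split_ifs with h
    · subst h; simpa using hm2
    · exact hd l)
  exact ⟨T, Relation.ReflTransGen.head ⟨m + 1, hm1, by omega, by simpa using hmS, rfl⟩ hT, hTC⟩

lemma mem_enc (i k j r : ℕ) (hj : j < i) (hr : r < 4) :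
    4 * j + r + 1 ∈ enc i k ↔ (if Nat.testBit k j then r = 0 ∨ r = 3 else r = 1 ∨ r = 2) := by
  unfold enc
  simp only [Finset.mem_biUnion, Finset.mem_Icc]
  constructor
  · rintro ⟨a, ha, h⟩
    have : a - 1 = j := by
      split_ifs at h <;> simp only [Finset.mem_insert, Finset.mem_singleton] at h <;> omega
    rw [this] at h
    split_ifs at h ⊢ <;> simp only [Finset.mem_insert, Finset.mem_singleton] at h <;> omega
  · intro h
    refine ⟨j + 1, by omega, ?_⟩
    simp only [Nat.add_sub_cancel]
    split_ifs at h ⊢ <;> simp only [Finset.mem_insert, Finset.mem_singleton] <;> omega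

lemma enc_bd {i k p : ℕ} (h : p ∈ enc i k) : 1 ≤ p ∧ p ≤ 4 * i := by
  unfold enc at h
  simp only [Finset.mem_biUnion, Finset.mem_Icc] at h
  obtain ⟨a, ha, h⟩ := h
  split_ifs at h <;> simp only [Finset.mem_insert, Finset.mem_singleton] at h <;> omega

lemma cnt_enc_step (i k j : ℕ) (hj : j < i) :
    cnt (enc i k) (4 * j + 1) = cnt (enc i k) (4 * j) + (if Nat.testBit k j then 1 else 0) ∧
    cnt (enc i k) (4 * j + 2) = cnt (enc i k) (4 * j) + 1 ∧
    cnt (enc i k) (4 * j + 3) = cnt (enc i k) (4 * j) + (if Nat.testBit k j then 1 else 2) ∧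
    cnt (enc i k) (4 * j + 4) = cnt (enc i k) (4 * j) + 2 := by
  have h0 := mem_enc i k j 0 hj (by omega)
  have h1 := mem_enc i k j 1 hj (by omega)
  have h2 := mem_enc i k j 2 hj (by omega)
  have h3 := mem_enc i k j 3 hj (by omega)
  have c0 := cnt_succ (enc i k) (4 * j)
  have c1 := cnt_succ (enc i k) (4 * j + 1)
  have c2 := cnt_succ (enc i k) (4 * j + 2)
  have c3 := cnt_succ (enc i k) (4 * j + 3)
  simp only [Nat.add_zero, Nat.add_assoc, Nat.reduceAdd] at h0 h1 h2 h3 c0 c1 c2 c3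
  cases hb : Nat.testBit k j <;> simp [hb] at h0 h1 h2 h3 <;> simp [h0, h1, h2, h3] at c0 c1 c2 c3 <;>
    simp <;> omega

lemma cnt_enc (i k : ℕ) : ∀ j, j ≤ i → cnt (enc i k) (4 * j) = 2 * j := by
  intro j
  induction j with
  | zero => intro _; exact cnt_zero (fun h => by have := enc_bd h; omega)
  | succ j ih =>
    intro hj
    have h := (cnt_enc_step i k j (by omega)).2.2.2
    rw [ih (by omega)] at h
    rw [Nat.mul_succ, h]; omega

lemma cnt_enc_ge (i k m : ℕ) (hm : 4 * i ≤ m) : cnt (enc i k) m = 2 * i := by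
  rw [← cnt_enc i k i le_rfl]
  unfold cnt
  congr 1
  ext x
  simp only [Finset.mem_filter]
  constructor
  · rintro ⟨h, _⟩; exact ⟨h, (enc_bd h).2⟩
  · rintro ⟨h, _⟩; exact ⟨h, by omega⟩

lemma cond_of_win {i : ℕ} {C : Finset ℕ} (h : GBit i C) (j : ℕ) (hj : j < i) :
    2 * j + 2 ≤ cnt C (4 * j + 4) ∧ 2 * j + 1 ≤ cnt C (4 * j + 2) ∧
      (2 * j + 1 ≤ cnt C (4 * j + 1) ∨ 2 * j + 2 ≤ cnt C (4 * j + 3)) := by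
  obtain ⟨k, _, T, hT, hTC⟩ := h
  have hd : ∀ m, cnt (enc i k) m ≤ cnt C m :=
    fun m => (leftShift_cnt hT m).trans (cnt_mono_set hTC m)
  obtain ⟨s1, s2, s3, s4⟩ := cnt_enc_step i k j hj
  have s0 := cnt_enc i k j hj.le
  have d1 := hd (4 * j + 1)
  have d2 := hd (4 * j + 2)
  have d3 := hd (4 * j + 3)
  have d4 := hd (4 * j + 4)
  split_ifs at s1 s3 <;> omega

lemma win_of_cond {i : ℕ} {C : Finset ℕ} (h0 : 0 ∉ C) (h : ∀ j < i,
    2 * j + 2 ≤ cnt C (4 * j + 4) ∧ 2 * j + 1 ≤ cnt C (4 * j + 2) ∧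
      (2 * j + 1 ≤ cnt C (4 * j + 1) ∨ 2 * j + 2 ≤ cnt C (4 * j + 3))) : GBit i C := by
  have h4 : ∀ j ≤ i, 2 * j ≤ cnt C (4 * j) := by
    intro j hj
    obtain _ | j := j
    · omega
    · exact (h j (by omega)).1
  refine ⟨Nat.ofBits (fun j : Fin i => decide (2 * j.1 + 1 ≤ cnt C (4 * j.1 + 1))),
    Nat.ofBits_lt_two_pow _, exists_leftShift h0 _ _ rfl ?_⟩
  intro m
  rcases Nat.lt_or_ge m (4 * i) with hm | hm
  · have hj : m / 4 < i := by omega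
    obtain ⟨j, hjm⟩ : ∃ j, m / 4 = j := ⟨_, rfl⟩
    rw [hjm] at hj
    have hb := Nat.testBit_ofBits_lt
      (fun j : Fin i => decide (2 * j.1 + 1 ≤ cnt C (4 * j.1 + 1))) j hj
    generalize Nat.ofBits (fun j : Fin i => decide (2 * j.1 + 1 ≤ cnt C (4 * j.1 + 1))) = k at *
    obtain ⟨s1, s2, s3, s4⟩ := cnt_enc_step i k j hj
    have s0 := cnt_enc i k j hj.le
    obtain ⟨a, b, c⟩ := h j hj
    have a0 := h4 j hj.le
    have m1 := cnt_mono C (show 4 * j ≤ 4 * j + 1 by omega)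
    have m2 := cnt_mono C (show 4 * j + 2 ≤ 4 * j + 3 by omega)
    simp only [hb, decide_eq_true_eq] at s1 s3
    have : m = 4 * j ∨ m = 4 * j + 1 ∨ m = 4 * j + 2 ∨ m = 4 * j + 3 := by omega
    rcases this with rfl | rfl | rfl | rfl <;> split_ifs at s1 s3 <;> omega
  · rw [cnt_enc_ge _ _ _ hm]
    exact (h4 i le_rfl).trans (cnt_mono C hm)

/-- In the `i`-bit roof game `G_{i-bit}`, no ceiling has more than
two distinct direct left-shifts. -/
theorem stmt9 (i : ℕ) (hi : 1 ≤ i) (C : Finset ℕ)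
    (hC : IsCeiling (4 * i) (GBit i) C) :
    ¬ ∃ S₁ S₂ S₃ : Finset ℕ, DLS C S₁ ∧ DLS C S₂ ∧ DLS C S₃ ∧
      S₁ ≠ S₂ ∧ S₁ ≠ S₃ ∧ S₂ ≠ S₃ := by
  rintro ⟨S₁, S₂, S₃, h1, h2, h3, h12, h13, h23⟩
  obtain ⟨⟨hsub, hlose, -⟩, hshift⟩ := hC
  have h0 : 0 ∉ C := fun h => by have := Finset.mem_Icc.1 (hsub h); omega
  have hfail : ∃ j < i, ¬ (2 * j + 2 ≤ cnt C (4 * j + 4) ∧ 2 * j + 1 ≤ cnt C (4 * j + 2) ∧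
      (2 * j + 1 ≤ cnt C (4 * j + 1) ∨ 2 * j + 2 ≤ cnt C (4 * j + 3))) := by
    by_contra hcon
    push Not at hcon
    refine hlose (win_of_cond h0 fun j hj => ?_)
    by_contra hn
    have := hcon j hj
    omega
  obtain ⟨j, hj, hjf⟩ := hfail
  have key : ∀ S, DLS C S → ∃ p, 2 ≤ p ∧ S = insert (p - 1) (C.erase p) ∧
      ((cnt C (4 * j + 4) < 2 * j + 2 → p - 1 = 4 * j + 4) ∧
      (cnt C (4 * j + 2) < 2 * j + 1 → p - 1 = 4 * j + 2) ∧
      (cnt C (4 * j + 1) < 2 * j + 1 ∧ cnt C (4 * j + 3) < 2 * j + 2 →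
        p - 1 = 4 * j + 1 ∨ p - 1 = 4 * j + 3)) := by
    intro S hS
    have hS' := hS
    obtain ⟨p, hp, hp2, hq, rfl⟩ := hS
    have hne : insert (p - 1) (C.erase p) ≠ C := fun h =>
      hq (h ▸ Finset.mem_insert_self _ _)
    have hw := cond_of_win (hshift _ (Relation.ReflTransGen.single hS') hne) j hj
    simp only [cnt_shift hp hp2 hq] at hw
    refine ⟨p, hp2, rfl, ?_⟩
    split_ifs at hw <;> omega
  obtain ⟨p, hp, rfl, kp⟩ := key _ h1
  obtain ⟨q, hq, rfl, kq⟩ := key _ h2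
  obtain ⟨r, hr, rfl, kr⟩ := key _ h3
  have npq : p ≠ q := by rintro rfl; exact h12 rfl
  have npr : p ≠ r := by rintro rfl; exact h13 rfl
  have nqr : q ≠ r := by rintro rfl; exact h23 rfl
  clear h12 h13 h23 h1 h2 h3
  omega
end

section
/- There exists a constant c > 0 such that for all i ≥ 1, the i-bit roof game G_{i-bit} (on n = 4i players) has at most c · n^5 ceilings; in particular, the number of ceilings of G_{i-bit} is polynomially bounded in n, while the set {S_{0,i}, …, S_{2^i−1,i}} of roofs of G_{i-bit} has cardinality 2^i = 2^{n/4}. -/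
/-- prefix count -/
def pc (S : Finset ℕ) (p : ℕ) : ℕ := (S.filter (· ≤ p)).card

theorem pc_succ (S : Finset ℕ) (p : ℕ) :
    pc S (p + 1) = pc S p + if p + 1 ∈ S then 1 else 0 := by
  unfold pc
  split_ifs with h
  · have : S.filter (· ≤ p + 1) = insert (p + 1) (S.filter (· ≤ p)) := by
      ext x
      simp only [Finset.mem_filter, Finset.mem_insert]
      constructor
      · rintro ⟨h1, h2⟩
        by_cases hx : x = p + 1
        · exact Or.inl hx
        · exact Or.inr ⟨h1, by omega⟩
      · rintro (rfl | ⟨h1, h2⟩)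
        · exact ⟨h, le_rfl⟩
        · exact ⟨h1, by omega⟩
    rw [this, Finset.card_insert_of_notMem (by simp)]
  · congr 1
    ext x
    simp only [Finset.mem_filter]
    constructor
    · rintro ⟨h1, h2⟩
      have : x ≠ p + 1 := fun e => h (e ▸ h1)
      exact ⟨h1, by omega⟩
    · rintro ⟨h1, h2⟩
      exact ⟨h1, by omega⟩

theorem pc_zero (S : Finset ℕ) (h : 0 ∉ S) : pc S 0 = 0 := by
  unfold pc
  rw [Finset.card_eq_zero, Finset.filter_eq_empty_iff]
  intro x hx hx0
  have : x = 0 := by omega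
  exact h (this ▸ hx)

theorem pc_mono (S : Finset ℕ) {p q : ℕ} (h : p ≤ q) : pc S p ≤ pc S q := by
  induction q, h using Nat.le_induction with
  | base => rfl
  | succ q _ ih => rw [pc_succ]; omega

theorem pc_le_add (S : Finset ℕ) {p q : ℕ} (h : p ≤ q) : pc S q ≤ pc S p + (q - p) := by
  induction q, h using Nat.le_induction with
  | base => omega
  | succ q _ ih => rw [pc_succ]; split_ifs <;> omega

theorem pc_top (S : Finset ℕ) {n p : ℕ} (hS : S ⊆ Finset.Icc 1 n) (h : n ≤ p) :
    pc S p = pc S n := by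
  unfold pc
  congr 1
  apply Finset.filter_congr
  intro x hx
  have := Finset.mem_Icc.1 (hS hx)
  constructor <;> intro <;> omega

theorem pc_sub {S T : Finset ℕ} (h : S ⊆ T) (p : ℕ) : pc S p ≤ pc T p :=
  Finset.card_le_card (Finset.filter_subset_filter _ h)

theorem pc_shift (S : Finset ℕ) (q p : ℕ) (h1 : q + 1 ∈ S) (h2 : q ∉ S) :
    pc (insert q (S.erase (q + 1))) p = pc S p + if p = q then 1 else 0 := by
  unfold pc
  rw [Finset.filter_insert, Finset.filter_erase]
  by_cases hq : q ≤ p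
  · rw [if_pos hq, Finset.card_insert_of_notMem (by simp [h2])]
    by_cases hp : p = q
    · subst hp
      rw [Finset.erase_eq_of_notMem (by simp)]
      simp
    · have hm : q + 1 ∈ S.filter (· ≤ p) := by
        simp only [Finset.mem_filter]; exact ⟨h1, by omega⟩
      rw [Finset.card_erase_add_one hm]
      simp [hp]
  · rw [if_neg hq, Finset.erase_eq_of_notMem (by simp; omega), if_neg (by omega)]
    rfl

theorem leftShift_pc {S T : Finset ℕ} (h : LeftShift S T) (p : ℕ) : pc S p ≤ pc T p := by
  induction h with
  | refl => rfl
  | tail _ h ih =>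
    obtain ⟨r, hr, h2, h3, rfl⟩ := h
    obtain ⟨q, rfl⟩ : ∃ q, r = q + 1 := ⟨r - 1, by omega⟩
    rw [Nat.add_sub_cancel] at *
    rw [pc_shift _ _ _ hr h3]
    omega

theorem shift_sum (S : Finset ℕ) (q : ℕ) (h1 : q + 1 ∈ S) (h2 : q ∉ S) :
    ∑ x ∈ insert q (S.erase (q + 1)), x < ∑ x ∈ S, x := by
  rw [Finset.sum_insert (by simp [h2]), ← Finset.add_sum_erase S (fun x => x) h1]
  simp

theorem exists_shift (C : Finset ℕ) (hC : 0 ∉ C) (N : ℕ) : ∀ S : Finset ℕ, ∑ x ∈ S, x ≤ N →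
    0 ∉ S → (∀ p, pc S p ≤ pc C p) → ∃ T, LeftShift S T ∧ T ⊆ C := by
  induction N using Nat.strong_induction_on with
  | _ N ih =>
  intro S hN hS0 hdom
  by_cases hsub : S ⊆ C
  · exact ⟨S, Relation.ReflTransGen.refl, hsub⟩
  have hex : ∃ x, x ∈ S ∧ x ∉ C := Finset.not_subset.1 hsub
  classical
  let x := Nat.find hex
  obtain ⟨hxS, hxC⟩ : x ∈ S ∧ x ∉ C := Nat.find_spec hex
  have hlow : ∀ z < x, z ∈ S → z ∈ C := by
    intro z hz hzS
    by_contra hzC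
    exact Nat.find_min hex hz ⟨hzS, hzC⟩
  clear_value x
  obtain ⟨w, rfl⟩ : ∃ w, x = w + 1 := by
    cases x with
    | zero => exact absurd hxS hS0
    | succ w => exact ⟨w, rfl⟩
  have h1 := hdom (w + 1)
  rw [pc_succ, pc_succ, if_pos hxS, if_neg hxC] at h1
  obtain ⟨y, hyC, hyS, hyw⟩ : ∃ y, y ∈ C ∧ y ∉ S ∧ y ≤ w := by
    by_contra! hno
    have : pc C w ≤ pc S w := by
      apply Finset.card_le_card
      intro y hy
      simp only [Finset.mem_filter] at *
      refine ⟨?_, hy.2⟩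
      by_contra hyS
      have := hno y hy.1 hyS
      omega
    omega
  let q := Nat.findGreatest (fun q => q ∉ S) w
  have hqS : q ∉ S := Nat.findGreatest_spec (P := fun q => q ∉ S) hyw hyS
  have hyq : y ≤ q := Nat.le_findGreatest hyw hyS
  have hqw : q ≤ w := Nat.findGreatest_le w
  have hgr : ∀ z, q < z → z ≤ w → z ∈ S := by
    intro z hz hzw
    have := Nat.findGreatest_is_greatest hz hzw
    simpa using this
  clear_value q
  have hq1 : q + 1 ∈ S := by
    by_cases h : q = w
    · exact h ▸ hxS
    · exact hgr _ (by omega) (by omega)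
  have hq0 : 1 ≤ q := by
    rcases Nat.eq_zero_or_pos y with h | h
    · exact absurd (h ▸ hyC) hC
    · omega
  have hlt : pc S q < pc C q := by
    apply Finset.card_lt_card
    rw [Finset.ssubset_iff_of_subset]
    · exact ⟨y, by simp [hyC, hyq], by simp [hyS]⟩
    · intro z hz
      simp only [Finset.mem_filter] at *
      exact ⟨hlow z (by omega) hz.1, hz.2⟩
  have hs := shift_sum S q hq1 hqS
  obtain ⟨T, hT, hTC⟩ := ih (∑ x ∈ insert q (S.erase (q + 1)), x) (by omega)
    (insert q (S.erase (q + 1))) le_rfl (by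
      simp only [Finset.mem_insert, Finset.mem_erase, not_or, not_and]
      exact ⟨by omega, fun _ => hS0⟩) (by
      intro p
      rw [pc_shift _ _ _ hq1 hqS]
      split_ifs with hp
      · subst hp; omega
      · exact hdom p)
  refine ⟨T, Relation.ReflTransGen.head ⟨q + 1, hq1, by omega, ?_, ?_⟩ hT, hTC⟩
  · simpa using hqS
  · simp

theorem mem_enc_s10 (i k x : ℕ) : x ∈ enc i k ↔ ∃ j < i,
    (k.testBit j = true ∧ (x = 4 * j + 1 ∨ x = 4 * j + 4)) ∨
    (k.testBit j = false ∧ (x = 4 * j + 2 ∨ x = 4 * j + 3)) := by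
  unfold enc
  simp only [Finset.mem_biUnion, Finset.mem_Icc]
  constructor
  · rintro ⟨j, hj, hx⟩
    refine ⟨j - 1, by omega, ?_⟩
    split_ifs at hx with h
    · left; exact ⟨h, by simpa using hx⟩
    · right; exact ⟨by simpa using h, by simpa using hx⟩
  · rintro ⟨j, hj, hx⟩
    refine ⟨j + 1, by omega, ?_⟩
    rcases hx with ⟨h, hx⟩ | ⟨h, hx⟩ <;> simp [h, hx]

theorem enc_sub (i k : ℕ) : enc i k ⊆ Finset.Icc 1 (4 * i) := by
  intro x hx
  obtain ⟨j, hj, h⟩ := (mem_enc_s10 _ _ _).1 hx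
  rw [Finset.mem_Icc]
  omega

theorem enc1 (i k j : ℕ) (hj : j < i) : 4 * j + 1 ∈ enc i k ↔ k.testBit j = true := by
  rw [mem_enc_s10]
  constructor
  · rintro ⟨l, hl, h⟩
    obtain rfl : l = j := by omega
    rcases h with h | h
    · exact h.1
    · omega
  · intro h; exact ⟨j, hj, Or.inl ⟨h, by omega⟩⟩

theorem enc4 (i k j : ℕ) (hj : j < i) : 4 * j + 4 ∈ enc i k ↔ k.testBit j = true := by
  rw [mem_enc_s10]
  constructor
  · rintro ⟨l, hl, h⟩
    obtain rfl : l = j := by omega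
    rcases h with h | h
    · exact h.1
    · omega
  · intro h; exact ⟨j, hj, Or.inl ⟨h, by omega⟩⟩

theorem enc2 (i k j : ℕ) (hj : j < i) : 4 * j + 2 ∈ enc i k ↔ k.testBit j = false := by
  rw [mem_enc_s10]
  constructor
  · rintro ⟨l, hl, h⟩
    obtain rfl : l = j := by omega
    rcases h with h | h
    · omega
    · exact h.1
  · intro h; exact ⟨j, hj, Or.inr ⟨h, by omega⟩⟩

theorem enc3 (i k j : ℕ) (hj : j < i) : 4 * j + 3 ∈ enc i k ↔ k.testBit j = false := by
  rw [mem_enc_s10]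
  constructor
  · rintro ⟨l, hl, h⟩
    obtain rfl : l = j := by omega
    rcases h with h | h
    · omega
    · exact h.1
  · intro h; exact ⟨j, hj, Or.inr ⟨h, by omega⟩⟩

theorem zero_notMem {S : Finset ℕ} {n : ℕ} (h : S ⊆ Finset.Icc 1 n) : 0 ∉ S := fun h0 => by
  have := Finset.mem_Icc.1 (h h0); omega

theorem pc_enc_block (i k j : ℕ) (hj : j < i) (h0 : pc (enc i k) (4 * j) = 2 * j) :
    pc (enc i k) (4 * j + 1) = 2 * j + (if k.testBit j then 1 else 0) ∧
    pc (enc i k) (4 * j + 2) = 2 * j + 1 ∧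
    pc (enc i k) (4 * j + 3) = 2 * j + (if k.testBit j then 1 else 2) ∧
    pc (enc i k) (4 * j + 4) = 2 * j + 2 := by
  have a1 := pc_succ (enc i k) (4 * j)
  have a2 := pc_succ (enc i k) (4 * j + 1)
  have a3 := pc_succ (enc i k) (4 * j + 2)
  have a4 := pc_succ (enc i k) (4 * j + 3)
  simp only [Nat.add_assoc, Nat.reduceAdd, enc1 i k j hj, enc2 i k j hj, enc3 i k j hj,
    enc4 i k j hj] at a1 a2 a3 a4
  cases h : k.testBit j <;> simp [h] at a1 a2 a3 a4 ⊢ <;> omega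

theorem pc_enc4 (i k j : ℕ) (hj : j ≤ i) : pc (enc i k) (4 * j) = 2 * j := by
  induction j with
  | zero => exact pc_zero _ (zero_notMem (enc_sub i k))
  | succ j ih =>
    have := (pc_enc_block i k j (by omega) (ih (by omega))).2.2.2
    rw [Nat.mul_add]; omega

/-- local characterisation of winning -/
def Good (i : ℕ) (C : Finset ℕ) : Prop :=
  (∀ m ≤ 2 * i, m ≤ pc C (2 * m)) ∧
  ∀ j < i, 2 * j + 1 ≤ pc C (4 * j + 1) ∨ 2 * j + 2 ≤ pc C (4 * j + 3)

theorem good_of_win {i : ℕ} {C : Finset ℕ} (h : GBit i C) : Good i C := by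
  obtain ⟨k, hk, T, hT, hTC⟩ := h
  have hd : ∀ p, pc (enc i k) p ≤ pc C p := fun p => (leftShift_pc hT p).trans (pc_sub hTC p)
  constructor
  · intro m hm
    have := hd (2 * m)
    obtain ⟨j, rfl | rfl⟩ : ∃ j, m = 2 * j ∨ m = 2 * j + 1 := ⟨m / 2, by omega⟩
    · have e := pc_enc4 i k j (by omega)
      rw [← Nat.mul_assoc] at *
      simp only [Nat.reduceMul] at *
      omega
    · have e := (pc_enc_block i k j (by omega) (pc_enc4 i k j (by omega))).2.1
      rw [show 2 * (2 * j + 1) = 4 * j + 2 by ring] at *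
      omega
  · intro j hj
    obtain ⟨e1, -, e3, -⟩ := pc_enc_block i k j hj (pc_enc4 i k j (by omega))
    have d1 := hd (4 * j + 1)
    have d3 := hd (4 * j + 3)
    cases h : k.testBit j <;> simp [h] at e1 e3 <;> omega

theorem win_of_good {i : ℕ} {C : Finset ℕ} (hC : 0 ∉ C) (h : Good i C) : GBit i C := by
  classical
  let k := Nat.ofBits (fun j : Fin i => decide (2 * j.1 + 1 ≤ pc C (4 * j.1 + 1)))
  have hk : k < 2 ^ i := Nat.ofBits_lt_two_pow _
  have hb : ∀ j < i, k.testBit j = decide (2 * j + 1 ≤ pc C (4 * j + 1)) := fun j hj =>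
    Nat.testBit_ofBits_lt _ j hj
  clear_value k
  refine ⟨k, hk, exists_shift C hC _ (enc i k) le_rfl (zero_notMem (enc_sub i k)) ?_⟩
  intro p
  by_cases hp : 4 * i ≤ p
  · rw [pc_top _ (enc_sub i k) hp, pc_enc4 i k i le_rfl]
    have := h.1 (2 * i) le_rfl
    have := pc_mono C hp
    rw [show 2 * (2 * i) = 4 * i by ring] at *
    omega
  · obtain ⟨j, hj⟩ : ∃ j, p = 4 * j ∨ p = 4 * j + 1 ∨ p = 4 * j + 2 ∨ p = 4 * j + 3 :=
      ⟨p / 4, by omega⟩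
    have hji : j < i := by omega
    have e0 := pc_enc4 i k j (by omega)
    obtain ⟨e1, e2, e3, -⟩ := pc_enc_block i k j hji e0
    have m0 := h.1 (2 * j) (by omega)
    have m2 := h.1 (2 * j + 1) (by omega)
    rw [show 2 * (2 * j) = 4 * j by ring] at m0
    rw [show 2 * (2 * j + 1) = 4 * j + 2 by ring] at m2
    have l1 := pc_mono C (show 4 * j ≤ 4 * j + 1 by omega)
    have l3 := pc_mono C (show 4 * j + 2 ≤ 4 * j + 3 by omega)
    have hc := h.2 j hji
    rw [hb j hji] at e1 e3
    by_cases hd : 2 * j + 1 ≤ pc C (4 * j + 1)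
    · simp only [hd, decide_true, if_true] at e1 e3
      rcases hj with rfl | rfl | rfl | rfl <;> omega
    · simp only [hd, decide_false] at e1 e3
      rcases hj with rfl | rfl | rfl | rfl <;> simp_all <;> omega

theorem pc_union (S T : Finset ℕ) (h : Disjoint S T) (p : ℕ) :
    pc (S ∪ T) p = pc S p + pc T p := by
  unfold pc
  rw [Finset.filter_union, Finset.card_union_of_disjoint]
  exact Finset.disjoint_filter_filter h

theorem pc_Icc (a b p : ℕ) : pc (Finset.Icc a b) p = min b p + 1 - a := by
  unfold pc
  rw [← Nat.card_Icc]
  congr 1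
  ext x
  simp only [Finset.mem_filter, Finset.mem_Icc]
  omega

/-- ceiling candidates of the first type (index `m` stands for `m + 1`) -/
def ceilA (i m : ℕ) : Finset ℕ := Finset.Icc 1 m ∪ Finset.Icc (2 * m + 3) (4 * i)

/-- ceiling candidates of the second type -/
def ceilB (i j : ℕ) : Finset ℕ :=
  Finset.Icc 1 (2 * j) ∪ (Finset.Icc (4 * j + 2) (4 * j + 2) ∪ Finset.Icc (4 * j + 4) (4 * i))

theorem pc_ceilA (i m p : ℕ) :
    pc (ceilA i m) p = (min m p + 1 - 1) + (min (4 * i) p + 1 - (2 * m + 3)) := by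
  unfold ceilA
  rw [pc_union, pc_Icc, pc_Icc]
  rw [Finset.disjoint_left]
  intro x
  simp only [Finset.mem_Icc]
  omega

theorem pc_ceilB (i j p : ℕ) :
    pc (ceilB i j) p = (min (2 * j) p + 1 - 1) + ((min (4 * j + 2) p + 1 - (4 * j + 2)) +
      (min (4 * i) p + 1 - (4 * j + 4))) := by
  unfold ceilB
  rw [pc_union, pc_union, pc_Icc, pc_Icc, pc_Icc]
  · rw [Finset.disjoint_left]
    intro x
    simp only [Finset.mem_Icc]
    omega
  · rw [Finset.disjoint_left]
    intro x
    simp only [Finset.mem_Icc, Finset.mem_union]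
    omega

theorem win_mono {i : ℕ} {C D : Finset ℕ} (h : GBit i C) (hCD : C ⊆ D) : GBit i D := by
  obtain ⟨k, hk, T, hT, hTC⟩ := h
  exact ⟨k, hk, T, hT, hTC.trans hCD⟩

theorem ceil_eq {i : ℕ} {C D : Finset ℕ} (hC : IsCeiling (4 * i) (GBit i) C)
    (hD : D ⊆ Finset.Icc 1 (4 * i)) (hl : ¬ GBit i D) (hdom : ∀ p, pc C p ≤ pc D p) : C = D := by
  obtain ⟨⟨hsub, _, hmax⟩, hsh⟩ := hC
  obtain ⟨T, hT, hTD⟩ := exists_shift D (zero_notMem hD) _ C le_rfl (zero_notMem hsub) hdom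
  have hTC : T = C := by
    by_contra hne
    exact hl (win_mono (hsh T hT hne) hTD)
  subst hTC
  refine Finset.Subset.antisymm hTD ?_
  intro x hx
  by_contra hxT
  exact hl (win_mono (hmax x (hD hx) hxT) (Finset.insert_subset hx hTD))

theorem ceil_mem {i : ℕ} {C : Finset ℕ} (hC : IsCeiling (4 * i) (GBit i) C) :
    C ∈ (Finset.range (2 * i)).image (ceilA i) ∪ (Finset.range i).image (ceilB i) := by
  have hsub := hC.1.1
  have h0 := zero_notMem hsub
  have hng : ¬ Good i C := fun h => hC.1.2.1 (win_of_good h0 h)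
  have hz := pc_zero C h0
  simp only [Finset.mem_union, Finset.mem_image, Finset.mem_range]
  unfold Good at hng
  rw [not_and_or] at hng
  rcases hng with hng | hng
  · left
    push Not at hng
    obtain ⟨m, hm, hlt⟩ := hng
    obtain ⟨m, rfl⟩ : ∃ l, m = l + 1 := ⟨m - 1, by omega⟩
    refine ⟨m, by omega, (ceil_eq hC ?_ ?_ ?_).symm⟩
    · intro x
      simp only [ceilA, Finset.mem_union, Finset.mem_Icc]
      omega
    · intro hw
      have := (good_of_win hw).1 (m + 1) hm
      rw [pc_ceilA] at this
      omega
    · intro p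
      rw [pc_ceilA]
      have b1 := pc_le_add C (Nat.zero_le p)
      rcases le_total p (2 * (m + 1)) with hp | hp
      · have := pc_mono C hp
        omega
      · rcases le_total p (4 * i) with hp2 | hp2
        · have := pc_le_add C hp
          omega
        · have := pc_top C hsub hp2
          have := pc_le_add C (show 2 * (m + 1) ≤ 4 * i by omega)
          omega
  · right
    push Not at hng
    obtain ⟨j, hj, hl1, hl3⟩ := hng
    refine ⟨j, hj, (ceil_eq hC ?_ ?_ ?_).symm⟩
    · intro x
      simp only [ceilB, Finset.mem_union, Finset.mem_Icc]
      omega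
    · intro hw
      have := (good_of_win hw).2 j hj
      rw [pc_ceilB, pc_ceilB] at this
      omega
    · intro p
      rw [pc_ceilB]
      have b1 := pc_le_add C (Nat.zero_le p)
      rcases le_total p (4 * j + 1) with hp | hp
      · have := pc_mono C hp
        omega
      · rcases le_total p (4 * j + 3) with hp1 | hp1
        · have := pc_mono C hp1
          have := pc_le_add C hp
          omega
        · rcases le_total p (4 * i) with hp2 | hp2
          · have := pc_le_add C hp1
            omega
          · have := pc_top C hsub hp2
            have := pc_le_add C (show 4 * j + 3 ≤ 4 * i by omega)
            omega

theorem ceil_card (i : ℕ) :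
    Nat.card {C : Finset ℕ // IsCeiling (4 * i) (GBit i) C} ≤ 3 * i := by
  let F := (Finset.range (2 * i)).image (ceilA i) ∪ (Finset.range i).image (ceilB i)
  have h1 : Nat.card {C : Finset ℕ // IsCeiling (4 * i) (GBit i) C} ≤ Nat.card F :=
    Nat.card_le_card_of_injective
      (fun C => (⟨C.1, ceil_mem C.2⟩ : F)) (by
        intro a b h
        simpa [Subtype.ext_iff] using h)
  have h2 : Nat.card F = F.card := by simp
  have h3 : F.card ≤ _ := Finset.card_union_le _ _
  have h4 : ((Finset.range (2 * i)).image (ceilA i)).card ≤ _ := Finset.card_image_le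
  have h5 : ((Finset.range i).image (ceilB i)).card ≤ _ := Finset.card_image_le
  rw [Finset.card_range] at h4 h5
  omega

/-- There is a constant `c > 0` such that for all `i ≥ 1`, the
`i`-bit roof game on `n = 4i` players has at most `c·n^5` ceilings, while its
set `{S_{0,i}, …, S_{2^i−1,i}}` of roofs has cardinality `2^i = 2^(n/4)`. -/
theorem stmt10 : ∃ c : ℝ, 0 < c ∧ ∀ i : ℕ, 1 ≤ i →
    (Nat.card {C : Finset ℕ // IsCeiling (4 * i) (GBit i) C} : ℝ) ≤
        c * ((4 * i : ℕ) : ℝ) ^ 5 ∧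
    ((Finset.range (2 ^ i)).image (enc i)).card = 2 ^ i := by
  refine ⟨1, one_pos, fun i hi => ⟨?_, ?_⟩⟩
  · rw [one_mul]
    have h1 := ceil_card i
    have h2 : 4 * i ≤ (4 * i) ^ 5 := Nat.le_self_pow (by norm_num) _
    exact_mod_cast (show _ ≤ (4 * i) ^ 5 by omega)
  · rw [Finset.card_image_of_injOn, Finset.card_range]
    intro a ha b hb hab
    simp only [Finset.coe_range, Set.mem_Iio] at ha hb
    apply Nat.eq_of_testBit_eq
    intro j
    by_cases hj : j < i
    · have e1 := enc1 i a j hj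
      have e2 := enc1 i b j hj
      have hab' : enc i a = enc i b := hab
      rw [hab', e2] at e1
      exact (Bool.eq_iff_iff.2 e1).symm
    · have hp : 2 ^ i ≤ 2 ^ j := Nat.pow_le_pow_right (by norm_num) (by omega)
      rw [Nat.testBit_lt_two_pow (by omega), Nat.testBit_lt_two_pow (by omega)]
end

section
/- For every n, the relation ⪯_MWC is a partial order on the set G_cwvg(n) of canonical weighted voting games on n players; the game in which every coalition is losing is its least element; and the map ρ sending a game G to the cardinality of its set of minimal winning coalitions is a rank function making (G_cwvg(n), ⪯_MWC) a graded poset: ρ equals 0 on the least element, ρ(G) ≤ ρ(G') whenever G ⪯_MWC G', and ρ(G') = ρ(G) + 1 whenever G' covers G in (G_cwvg(n), ⪯_MWC). -/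
/-- Player `i` is at least as desirable as player `j` in the simple game `v`. -/
def Desir {n : ℕ} (v : Finset (Fin n) → Prop) (i j : Fin n) : Prop :=
  ∀ S : Finset (Fin n), i ∉ S → j ∉ S → v (insert j S) → v (insert i S)

/-- `v` is a weighted voting game on `n` players. -/
def IsWVGv (n : ℕ) (v : Finset (Fin n) → Prop) : Prop :=
  ∃ q : ℝ, ∃ w : Fin n → ℝ, 0 ≤ q ∧ (∀ i, 0 ≤ w i) ∧
    ∀ S : Finset (Fin n), v S ↔ q ≤ ∑ i ∈ S, w i

/-- `v` is a canonical weighted voting game. -/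
def IsCWVGv (n : ℕ) (v : Finset (Fin n) → Prop) : Prop :=
  IsWVGv n v ∧ ∀ i j : Fin n, i ≤ j → Desir v i j

/-- `S` is a minimal winning coalition of `v`. -/
def IsMWCv (n : ℕ) (v : Finset (Fin n) → Prop) (S : Finset (Fin n)) : Prop :=
  v S ∧ ∀ p ∈ S, ¬ v (S.erase p)

/-- The type of canonical weighted voting games on `n` players. -/
abbrev CWVG (n : ℕ) := {v : Finset (Fin n) → Prop // IsCWVGv n v}

/-- The set of minimal winning coalitions of a canonical weighted voting game. -/
def mwcSet (n : ℕ) (G : CWVG n) : Set (Finset (Fin n)) :=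
  {S | IsMWCv n G.1 S}

/-- The relation `⪯_MWC`: there is a chain `G = G₁, …, G_k = G'` of canonical
weighted voting games in which each MWC set is a subset of the next with
cardinality exactly one less. -/
def MWCle (n : ℕ) (G G' : CWVG n) : Prop :=
  ∃ k : ℕ, 1 ≤ k ∧ ∃ c : ℕ → CWVG n, c 1 = G ∧ c k = G' ∧
    ∀ i : ℕ, 1 ≤ i → i < k →
      mwcSet n (c i) ⊆ mwcSet n (c (i + 1)) ∧
      (mwcSet n (c i)).ncard + 1 = (mwcSet n (c (i + 1))).ncard

/-- The rank function: the number of minimal winning coalitions. -/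
noncomputable def rho (n : ℕ) (G : CWVG n) : ℕ := (mwcSet n G).ncard

/-- `G'` covers `G` in `(G_cwvg(n), ⪯_MWC)`. -/
def CoversMWC (n : ℕ) (G G' : CWVG n) : Prop :=
  MWCle n G G' ∧ G ≠ G' ∧
    ∀ H : CWVG n, MWCle n G H → MWCle n H G' → H = G ∨ H = G'

/-- One step of the chain. -/
def MStep (n : ℕ) (G H : CWVG n) : Prop :=
  mwcSet n G ⊆ mwcSet n H ∧ (mwcSet n G).ncard + 1 = (mwcSet n H).ncard

lemma mwcle_iff (n : ℕ) (G G' : CWVG n) :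
    MWCle n G G' ↔ Relation.ReflTransGen (MStep n) G G' := by
  constructor
  · rintro ⟨k, hk, c, rfl, rfl, h⟩
    induction k, hk using Nat.le_induction with
    | base => exact Relation.ReflTransGen.refl
    | succ k hk ih =>
      exact (ih (fun i h1 h2 => h i h1 (by omega))).tail (h k hk (by omega))
  · intro h
    induction h with
    | refl => exact ⟨1, le_rfl, fun _ => G, rfl, rfl, fun i h1 h2 => by omega⟩
    | @tail b d _ hs ih =>
      obtain ⟨k, hk, c, h1, h2, h3⟩ := ih
      refine ⟨k + 1, by omega, fun j => if j ≤ k then c j else d, ?_, ?_, ?_⟩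
      · simp [hk, h1]
      · simp
      · intro i hi hik
        by_cases hlt : i < k
        · have e1 : i ≤ k := hlt.le
          have e2 : i + 1 ≤ k := hlt
          simp only [e1, e2, if_true]
          exact h3 i hi hlt
        · have : i = k := by omega
          subst this
          simp only [le_refl, if_true, h2]
          simpa [MStep] using hs

lemma wvg_mono {n : ℕ} {v : Finset (Fin n) → Prop} (h : IsWVGv n v)
    {S T : Finset (Fin n)} (hST : S ⊆ T) (hS : v S) : v T := by
  obtain ⟨q, w, _, hw, hv⟩ := h
  rw [hv] at hS ⊢
  exact hS.trans (Finset.sum_le_sum_of_subset_of_nonneg hST (fun i _ _ => hw i))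

lemma exists_mwc {n : ℕ} {v : Finset (Fin n) → Prop}
    (S : Finset (Fin n)) : v S → ∃ T, T ⊆ S ∧ IsMWCv n v T := by
  induction S using Finset.strongInduction with
  | H S ih =>
    intro hS
    by_cases hm : ∀ p ∈ S, ¬ v (S.erase p)
    · exact ⟨S, Finset.Subset.refl _, hS, hm⟩
    · push Not at hm
      obtain ⟨p, hp, hv⟩ := hm
      obtain ⟨T, hT, hTm⟩ := ih _ (Finset.erase_ssubset hp) hv
      exact ⟨T, hT.trans (Finset.erase_subset _ _), hTm⟩

lemma game_ext {n : ℕ} {G H : CWVG n} (h : mwcSet n G = mwcSet n H) : G = H := by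
  have key : ∀ {A B : CWVG n}, mwcSet n A = mwcSet n B → ∀ S, A.1 S → B.1 S := by
    intro A B hAB S hS
    obtain ⟨T, hT, hm⟩ := exists_mwc S hS
    have : T ∈ mwcSet n B := hAB ▸ hm
    exact wvg_mono B.2.1 hT this.1
  apply Subtype.ext
  funext S
  exact propext ⟨key h S, key h.symm S⟩

lemma rtg_mono {n : ℕ} {G H : CWVG n} (h : Relation.ReflTransGen (MStep n) G H) :
    mwcSet n G ⊆ mwcSet n H := by
  induction h with
  | refl => exact fun _ h => h
  | tail _ hs ih => exact ih.trans hs.1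

lemma rtg_rho {n : ℕ} {G H : CWVG n} (h : Relation.ReflTransGen (MStep n) G H) :
    rho n G ≤ rho n H := Set.ncard_le_ncard (rtg_mono h) (Set.toFinite _)

/-- A separating weight vector. -/
def SepW {n : ℕ} (v : Finset (Fin n) → Prop) (w : Fin n → ℝ) : Prop :=
  ∀ L S, ¬ v L → v S → ∑ i ∈ L, w i < ∑ i ∈ S, w i

open Classical in
lemma wvg_of_sep {n : ℕ} {v : Finset (Fin n) → Prop} {w : Fin n → ℝ} (hw : ∀ i, 0 ≤ w i)
    (h : SepW v w) : IsWVGv n v := by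
  by_cases hne : ∃ S, v S
  · obtain ⟨S₀, hS₀⟩ := hne
    obtain ⟨T, hT, hmin⟩ := Finset.exists_min_image (Finset.univ.filter v)
      (fun S => ∑ i ∈ S, w i) ⟨S₀, by simpa using hS₀⟩
    refine ⟨∑ i ∈ T, w i, w, Finset.sum_nonneg (fun i _ => hw i), hw, fun S => ?_⟩
    constructor
    · intro hS
      exact hmin S (by simpa using hS)
    · intro hS
      by_contra hc
      have := h S T hc (by simpa using hT)
      linarith
  · push Not at hne
    refine ⟨∑ i, w i + 1, w, ?_, hw, fun S => ?_⟩
    · have := Finset.sum_nonneg (s := Finset.univ) (fun i _ => hw i)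
      linarith
    · have := Finset.sum_le_sum_of_subset_of_nonneg (Finset.subset_univ S)
        (fun i _ _ => hw i)
      refine ⟨fun h => (hne S h).elim, fun h => ?_⟩
      linarith

lemma cwvg_of_sep {n : ℕ} {v : Finset (Fin n) → Prop} {w : Fin n → ℝ} (hw : ∀ i, 0 ≤ w i)
    (hs : Antitone w) (h : SepW v w) : IsCWVGv n v := by
  refine ⟨wvg_of_sep hw h, fun i j hij S hi hj hv => ?_⟩
  by_contra hc
  have := h _ _ hc hv
  rw [Finset.sum_insert hi, Finset.sum_insert hj] at this
  linarith [hs hij]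

lemma sum_swap {n : ℕ} (w : Fin n → ℝ) (i j : Fin n) (S : Finset (Fin n)) :
    ∑ k ∈ S, w (Equiv.swap i j k) = ∑ k ∈ S.map (Equiv.swap i j).toEmbedding, w k := by
  rw [Finset.sum_map]; rfl

lemma equiv_swap {n : ℕ} {v : Finset (Fin n) → Prop} {i j : Fin n}
    (h1 : Desir v i j) (h2 : Desir v j i) (S : Finset (Fin n)) :
    v (S.map (Equiv.swap i j).toEmbedding) ↔ v S := by
  by_cases hij : i = j
  · subst hij; simp
  by_cases hi : i ∈ S <;> by_cases hj : j ∈ S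
  · have : S.map (Equiv.swap i j).toEmbedding = S := by
      ext x
      simp only [Finset.mem_map_equiv, Equiv.symm_swap]
      rcases eq_or_ne x i with rfl | hx
      · simp [hi, hj]
      rcases eq_or_ne x j with rfl | hx'
      · simp [hi, hj]
      rw [Equiv.swap_apply_of_ne_of_ne hx hx']
    rw [this]
  · have : S.map (Equiv.swap i j).toEmbedding = insert j (S.erase i) := by
      ext x
      simp only [Finset.mem_map_equiv, Equiv.symm_swap, Finset.mem_insert, Finset.mem_erase]
      rcases eq_or_ne x i with rfl | hx
      · simp [hi, hj, hij]
      rcases eq_or_ne x j with rfl | hx'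
      · simp [hi, hj]
      rw [Equiv.swap_apply_of_ne_of_ne hx hx']
      simp [hx, hx']
    rw [this]
    conv_rhs => rw [← Finset.insert_erase hi]
    exact ⟨h1 _ (by simp) (by simp [hj]), h2 _ (by simp [hj]) (by simp)⟩
  · have : S.map (Equiv.swap i j).toEmbedding = insert i (S.erase j) := by
      ext x
      simp only [Finset.mem_map_equiv, Equiv.symm_swap, Finset.mem_insert, Finset.mem_erase]
      rcases eq_or_ne x i with rfl | hx
      · simp [hj]
      rcases eq_or_ne x j with rfl | hx'
      · simp [hi, hx]
      rw [Equiv.swap_apply_of_ne_of_ne hx hx']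
      simp [hx, hx']
    rw [this]
    conv_rhs => rw [← Finset.insert_erase hj]
    exact ⟨h2 _ (by simp) (by simp [hi]), h1 _ (by simp [hi]) (by simp)⟩
  · have : S.map (Equiv.swap i j).toEmbedding = S := by
      ext x
      simp only [Finset.mem_map_equiv, Equiv.symm_swap]
      rcases eq_or_ne x i with rfl | hx
      · simp [hi, hj]
      rcases eq_or_ne x j with rfl | hx'
      · simp [hi, hj]
      rw [Equiv.swap_apply_of_ne_of_ne hx hx']
    rw [this]

open Classical in
/-- Canonical games have sorted weights. -/
lemma sorted_weights {n : ℕ} {v : Finset (Fin n) → Prop} (h : IsCWVGv n v) :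
    ∃ w : Fin n → ℝ, (∀ i, 0 ≤ w i) ∧ Antitone w ∧ SepW v w := by
  obtain ⟨⟨q, w, _, hw, hv⟩, hd⟩ := h
  obtain ⟨σ, hσ, hmin⟩ := Finset.exists_min_image
    ((Finset.univ : Finset (Equiv.Perm (Fin n))).filter
      (fun σ => SepW v (fun k => w (σ k))))
    (fun σ => ∑ k : Fin n, (k : ℝ) * w (σ k))
    ⟨1, by
      simp only [Finset.mem_filter, Finset.mem_univ, true_and, Equiv.Perm.one_apply]
      intro L S hL hS
      rw [hv] at hL hS
      linarith⟩
  simp only [Finset.mem_filter, Finset.mem_univ, true_and] at hσ hmin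
  refine ⟨fun k => w (σ k), fun i => hw _, ?_, hσ⟩
  intro i j hij
  by_contra hc
  push Not at hc
  have hne : i ≠ j := by rintro rfl; exact lt_irrefl _ hc
  have hlt : i < j := lt_of_le_of_ne hij hne
  have hd' : Desir v j i := by
    intro S hj hi hvS
    by_contra hcc
    have := hσ _ _ hcc hvS
    rw [Finset.sum_insert hi, Finset.sum_insert hj] at this
    linarith
  have hsw := equiv_swap (hd i j hij) hd'
  have := hmin (σ * Equiv.swap i j) (by
    intro L S hL hS
    have e : ∀ S : Finset (Fin n), ∑ k ∈ S, w ((σ * Equiv.swap i j) k)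
        = ∑ k ∈ S.map (Equiv.swap i j).toEmbedding, w (σ k) :=
      fun S => sum_swap (fun k => w (σ k)) i j S
    rw [e, e]
    exact hσ _ _ (by rwa [hsw]) (by rwa [hsw]))
  have e2 : ∑ k : Fin n, (k : ℝ) * w ((σ * Equiv.swap i j) k)
      = ∑ k : Fin n, (k : ℝ) * w (σ k) - ((j : ℝ) - i) * (w (σ j) - w (σ i)) := by
    rw [eq_sub_iff_add_eq, ← eq_sub_iff_add_eq', ← Finset.sum_sub_distrib]
    rw [← Finset.sum_subset (Finset.subset_univ {i, j})]
    · rw [Finset.sum_pair hne]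
      simp
      ring
    · intro x _ hx
      simp only [Finset.mem_insert, Finset.mem_singleton, not_or] at hx
      rw [Equiv.Perm.mul_apply, Equiv.swap_apply_of_ne_of_ne hx.1 hx.2]
      ring
  rw [e2] at this
  have h1 : (0 : ℝ) < (j : ℝ) - i := by
    have : (i : ℝ) < (j : ℝ) := by exact_mod_cast hlt
    linarith
  have h2 : 0 < w (σ j) - w (σ i) := by linarith
  nlinarith [mul_pos h1 h2]

lemma pow_sum_inj {n : ℕ} {U V : Finset (Fin n)}
    (h : ∑ k ∈ U, (2 : ℝ) ^ (Fin.rev k : ℕ) = ∑ k ∈ V, (2 : ℝ) ^ (Fin.rev k : ℕ)) : U = V := by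
  let f : Fin n ↪ ℕ := ⟨fun k => (Fin.rev k : ℕ), fun a b hab => by
    exact Fin.rev_injective (Fin.ext hab)⟩
  have h' : ∑ k ∈ U.map f, 2 ^ k = ∑ k ∈ V.map f, 2 ^ k := by
    rw [Finset.sum_map, Finset.sum_map]
    have : ((∑ k ∈ U, 2 ^ (f k) : ℕ) : ℝ) = ((∑ k ∈ V, 2 ^ (f k) : ℕ) : ℝ) := by
      push_cast
      exact h
    exact_mod_cast this
  exact Finset.map_injective f (Finset.geomSum_injective (n := 2) le_rfl h')

lemma ev_lt {a b : ℝ} (c d : ℝ) (h : a < b) :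
    ∀ᶠ δ in nhdsWithin (0 : ℝ) (Set.Ioi 0), a + δ * c < b + δ * d := by
  have hc : Continuous (fun δ : ℝ => (b + δ * d) - (a + δ * c)) := by fun_prop
  have h0 := hc.tendsto 0
  simp only [zero_mul, add_zero] at h0
  have := (h0.mono_left (nhdsWithin_le_nhds (s := Set.Ioi 0))).eventually
    (lt_mem_nhds (show (0 : ℝ) < b - a by linarith))
  filter_upwards [this] with δ hδ
  linarith

open Classical in
/-- Generic sorted weights supported on `Iic i`. -/
lemma generic_weights {n : ℕ} {v : Finset (Fin n) → Prop} (h : IsCWVGv n v) (i : Fin n)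
    (hi : ∀ S, v S ↔ v (S.filter (· ≤ i))) :
    ∃ w : Fin n → ℝ, (∀ k, 0 ≤ w k) ∧ Antitone w ∧ SepW v w ∧
      (∀ S, ∑ k ∈ S, w k = ∑ k ∈ S.filter (· ≤ i), w k) ∧ (∀ k, i < k → w k = 0) ∧
      ∀ S T : Finset (Fin n), ∑ k ∈ S, w k = ∑ k ∈ T, w k →
        S.filter (· ≤ i) = T.filter (· ≤ i) := by
  obtain ⟨w, hw, hs, hsep⟩ := sorted_weights h
  let b : Fin n → ℝ := fun k => 2 ^ (Fin.rev k : ℕ)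
  have hb : ∀ k, 0 < b k := fun k => by positivity
  have hbs : Antitone b := by
    intro x y hxy
    apply pow_le_pow_right₀ (by norm_num)
    exact_mod_cast Fin.rev_le_rev.mpr hxy
  let F : Finset (Fin n) → Finset (Fin n) := fun S => S.filter (· ≤ i)
  let A : Finset (Fin n) → ℝ := fun S => ∑ k ∈ F S, w k
  let B : Finset (Fin n) → ℝ := fun S => ∑ k ∈ F S, b k
  have ev1 : ∀ᶠ δ in nhdsWithin (0 : ℝ) (Set.Ioi 0), ∀ L S, A L < A S →
      A L + δ * B L < A S + δ * B S := by
    rw [Filter.eventually_all]; intro L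
    rw [Filter.eventually_all]; intro S
    by_cases hLS : A L < A S
    · filter_upwards [ev_lt (B L) (B S) hLS] with δ hδ _ using hδ
    · exact Filter.Eventually.of_forall (fun δ hh => (hLS hh).elim)
  obtain ⟨δ, hδ, hpos⟩ := (ev1.and self_mem_nhdsWithin).exists
  have hpos : 0 < δ := hpos
  let w2 : Fin n → ℝ := fun k => if k ≤ i then w k + δ * b k else 0
  have hsum : ∀ S, ∑ k ∈ S, w2 k = A S + δ * B S := by
    intro S
    simp only [w2, A, B, F]
    rw [← Finset.sum_filter, Finset.sum_add_distrib, Finset.mul_sum]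
  have hFF : ∀ S, F (F S) = F S := by intro S; simp [F, Finset.filter_filter]
  refine ⟨w2, ?_, ?_, ?_, ?_, ?_, ?_⟩
  · intro k
    simp only [w2]
    split_ifs
    · have := hw k
      have := hb k
      positivity
    · exact le_rfl
  · intro x y hxy
    simp only [w2]
    by_cases hy : y ≤ i
    · rw [if_pos hy, if_pos (hxy.trans hy)]
      have := hs hxy
      have := mul_le_mul_of_nonneg_left (hbs hxy) hpos.le
      linarith
    · rw [if_neg hy]
      split_ifs
      · have := hw x
        have := hb x
        positivity
      · exact le_rfl
  · intro L S hL hS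
    rw [hsum, hsum]
    apply hδ
    exact hsep _ _ (by rwa [← hi]) (by rwa [← hi])
  · intro S
    rw [hsum]
    change _ = ∑ k ∈ F S, w2 k
    rw [hsum]
    simp only [A, B, hFF]
  · intro k hk
    simp [w2, not_le.mpr hk]
  · intro S T hST
    rw [hsum, hsum] at hST
    have hA : A S = A T := by
      rcases lt_trichotomy (A S) (A T) with hh | hh | hh
      · have := hδ _ _ hh; linarith
      · exact hh
      · have := hδ _ _ hh; linarith
    rw [hA] at hST
    have hB : B S = B T := mul_left_cancel₀ hpos.ne' (add_left_cancel hST)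
    exact pow_sum_inj hB

open Classical in
lemma exists_lower {n : ℕ} (G : CWVG n) (hne : ∃ S, G.1 S) :
    ∃ H : CWVG n, MStep n H G := by
  obtain ⟨v, hG⟩ := G
  simp only at hne
  by_cases h0 : v ∅
  · have hall : ∀ S, v S := fun S => wvg_mono hG.1 (Finset.empty_subset S) h0
    refine ⟨⟨fun _ => False, cwvg_of_sep (w := fun _ => 0) (fun _ => le_rfl)
      (fun _ _ _ => le_rfl) (fun _ _ _ h => h.elim)⟩, ?_⟩
    have e1 : mwcSet n ⟨fun _ => False, cwvg_of_sep (w := fun _ => 0) (fun _ => le_rfl)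
      (fun _ _ _ => le_rfl) (fun _ _ _ h => h.elim)⟩ = ∅ := by
      ext S; simp [mwcSet, IsMWCv]
    have e2 : mwcSet n ⟨v, hG⟩ = {∅} := by
      ext S
      simp only [mwcSet, IsMWCv, Set.mem_setOf_eq, Set.mem_singleton_iff, hall, not_true,
        true_and, imp_false]
      exact Finset.eq_empty_iff_forall_notMem.symm
    rw [MStep, e1, e2]
    simp
  have hmono : ∀ {S T : Finset (Fin n)}, S ⊆ T → v S → v T := fun h1 h2 => wvg_mono hG.1 h1 h2
  -- the last non-dummy player
  obtain ⟨i, hiR, himax⟩ : ∃ i, (∃ R, IsMWCv n v R ∧ i ∈ R) ∧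
      ∀ S, IsMWCv n v S → ∀ k ∈ S, k ≤ i := by
    obtain ⟨S₀, hS₀⟩ := hne
    obtain ⟨R, _, hR⟩ := exists_mwc S₀ hS₀
    have hRne : R.Nonempty := by
      rw [Finset.nonempty_iff_ne_empty]
      rintro rfl
      exact h0 hR.1
    obtain ⟨r, hr⟩ := hRne
    obtain ⟨i, hi, hmax⟩ := Finset.exists_max_image
      (Finset.univ.filter (fun i => ∃ R, IsMWCv n v R ∧ i ∈ R)) id
      ⟨r, by simpa using ⟨R, hR, hr⟩⟩
    refine ⟨i, by simpa using hi, fun S hS k hk => hmax k (by simpa using ⟨S, hS, hk⟩)⟩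
  have hF : ∀ S, v S ↔ v (S.filter (· ≤ i)) := by
    intro S
    refine ⟨fun hS => ?_, fun hS => hmono (Finset.filter_subset _ _) hS⟩
    obtain ⟨R, hRS, hR⟩ := exists_mwc S hS
    refine hmono (fun k hk => ?_) hR.1
    exact Finset.mem_filter.mpr ⟨hRS hk, himax R hR k hk⟩
  obtain ⟨w, hw, hs, hsep, hwF, hwz, hinj⟩ := generic_weights hG i hF
  obtain ⟨R, hR, hiR⟩ := hiR
  have hRF : R.filter (· ≤ i) = R := Finset.filter_true_of_mem (himax R hR)
  obtain ⟨T, hT, hTmin⟩ := Finset.exists_min_image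
    (Finset.univ.filter (fun S : Finset (Fin n) => v S ∧ i ∈ S ∧ S.filter (· ≤ i) = S))
    (fun S => ∑ k ∈ S, w k) ⟨R, by simp only [Finset.mem_filter, Finset.mem_univ, true_and]; exact ⟨hR.1, hiR, hRF⟩⟩
  simp only [Finset.mem_filter, Finset.mem_univ, true_and] at hT hTmin
  obtain ⟨hvT, hiT, hTF⟩ := hT
  obtain ⟨L₀, hL₀, hLmax⟩ := Finset.exists_max_image
    (Finset.univ.filter (fun S : Finset (Fin n) => ¬ v S))
    (fun S => ∑ k ∈ S, w k) ⟨∅, by simpa using h0⟩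
  simp only [Finset.mem_filter, Finset.mem_univ, true_and] at hL₀ hLmax
  -- erasing i from T loses
  have hTi : ¬ v (T.erase i) := by
    intro hc
    have h1 := hsep _ _ (hR.2 i hiR) hc
    have h2 := hTmin R ⟨hR.1, hiR, hRF⟩
    have h3 := Finset.add_sum_erase T w hiT
    have h4 := Finset.add_sum_erase R w hiR
    linarith
  have hTm : IsMWCv n v T := by
    refine ⟨hvT, fun p hp hc => ?_⟩
    by_cases hpi : p = i
    · subst hpi; exact hTi hc
    have hsub : (T.erase p).filter (· ≤ i) = T.erase p := by
      apply Finset.filter_true_of_mem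
      intro k hk
      have : k ∈ T.filter (· ≤ i) := by rw [hTF]; exact Finset.mem_of_mem_erase hk
      exact (Finset.mem_filter.mp this).2
    have h1 := hTmin (T.erase p) ⟨hc, Finset.mem_erase.mpr ⟨fun h => hpi h.symm, hiT⟩, hsub⟩
    have h2 := Finset.add_sum_erase T w hp
    have h3 := hw p
    have h4 := hinj (T.erase p) T (by linarith)
    rw [hsub, hTF] at h4
    exact (Finset.erase_eq_self.mp h4) hp
  -- the shift
  obtain ⟨t, ht⟩ : ∃ t, t = ∑ k ∈ T, w k - ∑ k ∈ L₀, w k := ⟨_, rfl⟩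
  have htpos : 0 < t := by
    have := hsep _ _ hL₀ hvT
    linarith
  have htle : t ≤ w i := by
    have h1 := hLmax _ hTi
    have h3 := Finset.add_sum_erase T w hiT
    linarith
  let w3 : Fin n → ℝ := fun k => w k - if k = i then t else 0
  have hsum3 : ∀ S, ∑ k ∈ S, w3 k = ∑ k ∈ S, w k - if i ∈ S then t else 0 := by
    intro S
    simp only [w3, Finset.sum_sub_distrib, Finset.sum_ite_eq']
  let u : Finset (Fin n) → Prop := fun S => v S ∧ S.filter (· ≤ i) ≠ T
  have hu : IsCWVGv n u := by
    apply cwvg_of_sep (w := w3)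
    · intro k
      simp only [w3]
      split_ifs with hk
      · subst hk; linarith
      · linarith [hw k]
    · intro x y hxy
      simp only [w3]
      have := hs hxy
      by_cases hx : x = i
      · subst hx
        by_cases hy : y = x
        · simp [hy]
        · have hlt : x < y := lt_of_le_of_ne hxy (Ne.symm hy)
          rw [hwz y hlt]
          simp [hy]
          linarith
      · rw [if_neg hx]
        split_ifs <;> linarith
    · intro L S hL hS
      have hLle : ∑ k ∈ L, w3 k ≤ ∑ k ∈ L₀, w k := by
        rw [hsum3]
        by_cases hvL : v L
        · have hLT : L.filter (· ≤ i) = T := by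
            by_contra hc
            exact hL ⟨hvL, hc⟩
          have hiL : i ∈ L := by
            rw [← hLT] at hiT
            exact (Finset.mem_filter.mp hiT).1
          rw [if_pos hiL, hwF, hLT]
          linarith
        · have := hLmax _ hvL
          split_ifs <;> linarith
      refine lt_of_le_of_lt hLle ?_
      rw [hsum3]
      by_cases hiS : i ∈ S
      · rw [if_pos hiS]
        have h1 := hTmin (S.filter (· ≤ i)) ⟨(hF S).mp hS.1, by simp [hiS], by
          simp [Finset.filter_filter]⟩
        rw [← hwF] at h1
        have h2 : ∑ k ∈ T, w k ≠ ∑ k ∈ S, w k := by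
          intro hc
          have := hinj _ _ hc
          rw [hTF] at this
          exact hS.2 this.symm
        have := lt_of_le_of_ne h1 h2
        linarith
      · rw [if_neg hiS]
        have := hsep _ _ hL₀ hS.1
        linarith
  refine ⟨⟨u, hu⟩, ?_⟩
  have hset : mwcSet n ⟨u, hu⟩ = mwcSet n ⟨v, hG⟩ \ {T} := by
    ext S
    simp only [mwcSet, Set.mem_setOf_eq, Set.mem_sdiff, Set.mem_singleton_iff]
    constructor
    · rintro ⟨⟨hvS, hST⟩, hmin⟩
      refine ⟨⟨hvS, fun p hp hc => ?_⟩, fun hc => hST (by rw [hc, hTF])⟩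
      have hpT : (S.erase p).filter (· ≤ i) = T := by
        by_contra hcc
        exact hmin p hp ⟨hc, hcc⟩
      have hpi : p ≤ i := by
        by_contra hcc
        apply hST
        rw [← hpT]
        ext k
        simp only [Finset.mem_filter, Finset.mem_erase]
        constructor
        · rintro ⟨a, b⟩
          exact ⟨⟨fun e => hcc (e ▸ b), a⟩, b⟩
        · rintro ⟨⟨_, a⟩, b⟩
          exact ⟨a, b⟩
      have hpnT : p ∉ T := by rw [← hpT]; simp
      have hTS : T ⊆ S := by
        rw [← hpT]
        exact (Finset.filter_subset _ _).trans (Finset.erase_subset _ _)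
      have hne : p ≠ i := fun e => hpnT (e ▸ hiT)
      have h1 : v (insert p (T.erase i)) := by
        apply hG.2 p i hpi _ (by simp [hpnT]) (by simp)
        rwa [Finset.insert_erase hiT]
      have h2 : v (S.erase i) := by
        refine hmono ?_ h1
        intro k hk
        rcases Finset.mem_insert.mp hk with rfl | hk
        · exact Finset.mem_erase.mpr ⟨hne, hp⟩
        · exact Finset.erase_subset_erase _ hTS hk
      refine hmin i (hTS hiT) ⟨h2, fun hcc => ?_⟩
      rw [← hcc] at hiT
      simp at hiT
    · rintro ⟨hS, hne⟩
      refine ⟨⟨hS.1, ?_⟩, fun p hp hc => hS.2 p hp hc.1⟩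
      rw [Finset.filter_true_of_mem (himax S hS)]
      exact hne
  refine ⟨by rw [hset]; exact Set.sdiff_subset, ?_⟩
  rw [hset]
  exact Set.ncard_sdiff_singleton_add_one (show T ∈ mwcSet n ⟨v, hG⟩ from hTm) (Set.toFinite _)

lemma least_aux {n : ℕ} (G₀ : CWVG n) (h : ∀ S, ¬ G₀.1 S) (m : ℕ) :
    ∀ G : CWVG n, rho n G = m → Relation.ReflTransGen (MStep n) G₀ G := by
  induction m with
  | zero =>
    intro G hG
    have h1 : mwcSet n G = ∅ := (Set.ncard_eq_zero (Set.toFinite _)).mp hG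
    have h2 : mwcSet n G₀ = ∅ := by
      ext S
      simp [mwcSet, IsMWCv, h]
    rw [game_ext (h2.trans h1.symm)]
  | succ m ih =>
    intro G hG
    have hne : ∃ S, G.1 S := by
      by_contra hc
      push Not at hc
      have h1 : mwcSet n G = ∅ := by
        ext S
        simp [mwcSet, IsMWCv, hc]
      rw [rho, h1] at hG
      simp at hG
    obtain ⟨H, hH⟩ := exists_lower G hne
    refine (ih H ?_).tail hH
    have := hH.2
    simp only [rho] at hG ⊢
    omega

theorem stmt15 (n : ℕ) :
    IsPartialOrder (CWVG n) (MWCle n) ∧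
    (∃ G₀ : CWVG n, ∀ S, ¬ G₀.1 S) ∧
    (∀ G₀ : CWVG n, (∀ S, ¬ G₀.1 S) →
      (∀ G : CWVG n, MWCle n G₀ G) ∧ rho n G₀ = 0) ∧
    (∀ G G' : CWVG n, MWCle n G G' → rho n G ≤ rho n G') ∧
    (∀ G G' : CWVG n, CoversMWC n G G' → rho n G' = rho n G + 1) := by
  refine ⟨?_, ?_, ?_, ?_, ?_⟩
  · exact
      { refl := fun G => (mwcle_iff n G G).mpr Relation.ReflTransGen.refl
        trans := fun a b c h1 h2 => by
          rw [mwcle_iff] at *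
          exact h1.trans h2
        antisymm := fun a b h1 h2 => by
          rw [mwcle_iff] at *
          exact game_ext ((rtg_mono h1).antisymm (rtg_mono h2)) }
  · exact ⟨⟨fun _ => False, cwvg_of_sep (w := fun _ => 0) (fun _ => le_rfl)
      (fun _ _ _ => le_rfl) (fun _ _ _ h => h.elim)⟩, fun _ h => h⟩
  · intro G₀ h
    refine ⟨fun G => (mwcle_iff n G₀ G).mpr (least_aux G₀ h _ G rfl), ?_⟩
    have h1 : mwcSet n G₀ = ∅ := by
      ext S
      simp [mwcSet, IsMWCv, h]
    simp [rho, h1]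
  · intro G G' h
    exact rtg_rho ((mwcle_iff n G G').mp h)
  · rintro G G' ⟨h1, hne, h2⟩
    rw [mwcle_iff] at h1
    rcases Relation.ReflTransGen.cases_head h1 with e | ⟨H, hs, hr⟩
    · exact (hne e).elim
    · rcases h2 H ((mwcle_iff _ _ _).mpr (Relation.ReflTransGen.single hs))
        ((mwcle_iff _ _ _).mpr hr) with e | e
      · subst e
        have := hs.2
        omega
      · subst e
        exact hs.2.symm
end
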